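/- Under the stability setup with hypotheses (H1), (H2), (H3), suppose for each n ∈ ℕ the function u^n : X_n → ℝ is a metric viscosity supersolution of H_n(x, u^n, |∇_{d_n} u^n|) = 0 on the geodesic space (X_n, d_n), and the family (u^n) is uniformly bounded. Then the lower semilimit u̲(x) := inf{ liminf_{n→∞} u^n(x_n) : x_n ∈ X_n, 𝖽(x_n, x) → 0 }, defined for x ∈ X_∞, is a metric viscosity supersolution of H_∞(x, u̲, |∇_{d_∞} u̲|) = 0 on (X_∞, d_∞). -/

import Mathlib

open Filter Metric Set Topology

/-- Local slope of `u` at `x`, relative to a set `s` and a distance-like function `ρ`. -/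
noncomputable def slopeWrt {α : Type*} [TopologicalSpace α] (s : Set α) (ρ : α → α → ℝ)
    (u : α → ℝ) (x : α) : ℝ :=
  Filter.limsup (fun y => |u y - u x| / ρ x y) (nhdsWithin x (s \ {x}))

/-- Upper local slope. -/
noncomputable def upperSlopeWrt {α : Type*} [TopologicalSpace α] (s : Set α) (ρ : α → α → ℝ)
    (u : α → ℝ) (x : α) : ℝ :=
  Filter.limsup (fun y => max (u y - u x) 0 / ρ x y) (nhdsWithin x (s \ {x}))

/-- Lower local slope. -/
noncomputable def lowerSlopeWrt {α : Type*} [TopologicalSpace α] (s : Set α) (ρ : α → α → ℝ)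
    (u : α → ℝ) (x : α) : ℝ :=
  Filter.limsup (fun y => max (u x - u y) 0 / ρ x y) (nhdsWithin x (s \ {x}))

/-- `u` is locally Lipschitz on `s` with respect to `ρ`. -/
def LocLipWrt {α : Type*} [TopologicalSpace α] (s : Set α) (ρ : α → α → ℝ)
    (u : α → ℝ) : Prop :=
  ∀ x ∈ s, ∃ K : ℝ, ∃ t ∈ nhdsWithin x s, ∀ y ∈ t ∩ s, ∀ z ∈ t ∩ s, |u y - u z| ≤ K * ρ y z

/-- `u` is of class `C^{1,-}`: locally Lipschitz, with continuous local slope which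
coincides with the lower local slope. -/
def IsC1MinusWrt {α : Type*} [TopologicalSpace α] (s : Set α) (ρ : α → α → ℝ)
    (u : α → ℝ) : Prop :=
  LocLipWrt s ρ u ∧ ContinuousOn (slopeWrt s ρ u) s ∧
    ∀ x ∈ s, lowerSlopeWrt s ρ u x = slopeWrt s ρ u x

/-- `u` is of class `C^{1,+}`: locally Lipschitz, with continuous local slope which
coincides with the upper local slope. -/
def IsC1PlusWrt {α : Type*} [TopologicalSpace α] (s : Set α) (ρ : α → α → ℝ)
    (u : α → ℝ) : Prop :=
  LocLipWrt s ρ u ∧ ContinuousOn (slopeWrt s ρ u) s ∧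
    ∀ x ∈ s, upperSlopeWrt s ρ u x = slopeWrt s ρ u x

/-- Upper semicontinuous envelope of `u` relative to `s`. -/
noncomputable def uscWrt {α : Type*} [TopologicalSpace α] (s : Set α) (u : α → ℝ) (x : α) : ℝ :=
  Filter.limsup u (nhdsWithin x s)

/-- Lower semicontinuous envelope of `u` relative to `s`. -/
noncomputable def lscWrt {α : Type*} [TopologicalSpace α] (s : Set α) (u : α → ℝ) (x : α) : ℝ :=
  Filter.liminf u (nhdsWithin x s)

/-- `H_a(x,r,p) = inf { H x r q | q ≥ 0, |q - p| ≤ a }`. -/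
noncomputable def Hlow {α : Type*} (H : α → ℝ → ℝ → ℝ) (a : ℝ) (x : α) (r p : ℝ) : ℝ :=
  sInf (H x r '' {q | 0 ≤ q ∧ |q - p| ≤ a})

/-- `H^a(x,r,p) = sup { H x r q | q ≥ 0, |q - p| ≤ a }`. -/
noncomputable def Hupp {α : Type*} (H : α → ℝ → ℝ → ℝ) (a : ℝ) (x : α) (r p : ℝ) : ℝ :=
  sSup (H x r '' {q | 0 ≤ q ∧ |q - p| ≤ a})

/-- Metric viscosity subsolution of `H(x, u, |∇u|) = 0` on the space `(s, ρ)`. -/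
def IsMVSubsolutionWrt {α : Type*} [TopologicalSpace α] (s : Set α) (ρ : α → α → ℝ)
    (H : α → ℝ → ℝ → ℝ) (u : α → ℝ) : Prop :=
  ∀ ψ₁ ψ₂ : α → ℝ, IsC1MinusWrt s ρ ψ₁ → LocLipWrt s ρ ψ₂ →
    ∀ x ∈ s, IsLocalMaxOn (fun y => uscWrt s u y - (ψ₁ y + ψ₂ y)) s x →
      Hlow H (uscWrt s (slopeWrt s ρ ψ₂) x) x (uscWrt s u x) (slopeWrt s ρ ψ₁ x) ≤ 0

/-- Metric viscosity supersolution of `H(x, u, |∇u|) = 0` on the space `(s, ρ)`. -/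
def IsMVSupersolutionWrt {α : Type*} [TopologicalSpace α] (s : Set α) (ρ : α → α → ℝ)
    (H : α → ℝ → ℝ → ℝ) (u : α → ℝ) : Prop :=
  ∀ ψ₁ ψ₂ : α → ℝ, IsC1PlusWrt s ρ ψ₁ → LocLipWrt s ρ ψ₂ →
    ∀ x ∈ s, IsLocalMinOn (fun y => lscWrt s u y - (ψ₁ y + ψ₂ y)) s x →
      0 ≤ Hupp H (uscWrt s (slopeWrt s ρ ψ₂) x) x (lscWrt s u x) (slopeWrt s ρ ψ₁ x)

/-- `(s, ρ)` is a geodesic space: any two points are joined by an isometric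
embedding of the interval `[0, ρ x y]`. -/
def IsGeodesicWrt {α : Type*} (s : Set α) (ρ : α → α → ℝ) : Prop :=
  ∀ x ∈ s, ∀ y ∈ s, ∃ γ : ℝ → α, γ 0 = x ∧ γ (ρ x y) = y ∧
    (∀ t ∈ Icc (0:ℝ) (ρ x y), γ t ∈ s) ∧
    ∀ t₁ ∈ Icc (0:ℝ) (ρ x y), ∀ t₂ ∈ Icc (0:ℝ) (ρ x y), ρ (γ t₁) (γ t₂) = |t₁ - t₂|

/-- Strict local maximum of `f` on `s` at `x`. -/
def IsStrictLocalMaxOn' {α : Type*} [TopologicalSpace α] (f : α → ℝ) (s : Set α) (x : α) : Prop :=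
  ∀ᶠ y in nhdsWithin x (s \ {x}), f y < f x

/-- Strict local minimum of `f` on `s` at `x`. -/
def IsStrictLocalMinOn' {α : Type*} [TopologicalSpace α] (f : α → ℝ) (s : Set α) (x : α) : Prop :=
  ∀ᶠ y in nhdsWithin x (s \ {x}), f x < f y

/-- `u` is locally bounded on `s`. -/
def LocBddWrt {α : Type*} [TopologicalSpace α] (s : Set α) (u : α → ℝ) : Prop :=
  ∀ x ∈ s, ∃ C : ℝ, ∀ᶠ y in nhdsWithin x s, |u y| ≤ C

/-- `ρ` is a metric on the subset `S` of the ambient metric space `Y`, bounded below by the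
ambient distance and inducing the subspace topology on `S`. -/
structure IsMetricOn {Y : Type*} [MetricSpace Y] (S : Set Y) (ρ : Y → Y → ℝ) : Prop where
  refl : ∀ x ∈ S, ρ x x = 0
  symm : ∀ x ∈ S, ∀ y ∈ S, ρ x y = ρ y x
  triangle : ∀ x ∈ S, ∀ y ∈ S, ∀ z ∈ S, ρ x z ≤ ρ x y + ρ y z
  ge_dist : ∀ x ∈ S, ∀ y ∈ S, dist x y ≤ ρ x y
  nhds_basis : ∀ x ∈ S, (nhdsWithin x S).HasBasis (fun ε : ℝ => 0 < ε)
    (fun ε => {y | y ∈ S ∧ ρ x y < ε})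

/-- Spatial local slope of `ψ : (0,∞) × X → ℝ` at `z = (t, x)`. -/
noncomputable def slopeSpWrt {α : Type*} [TopologicalSpace α] (s : Set α) (ρ : α → α → ℝ)
    (ψ : ℝ × α → ℝ) (z : ℝ × α) : ℝ :=
  Filter.limsup (fun y => |ψ (z.1, y) - ψ z| / ρ z.2 y) (nhdsWithin z.2 (s \ {z.2}))

/-- Spatial upper local slope. -/
noncomputable def upperSlopeSpWrt {α : Type*} [TopologicalSpace α] (s : Set α) (ρ : α → α → ℝ)
    (ψ : ℝ × α → ℝ) (z : ℝ × α) : ℝ :=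
  Filter.limsup (fun y => max (ψ (z.1, y) - ψ z) 0 / ρ z.2 y) (nhdsWithin z.2 (s \ {z.2}))

/-- Spatial lower local slope. -/
noncomputable def lowerSlopeSpWrt {α : Type*} [TopologicalSpace α] (s : Set α) (ρ : α → α → ℝ)
    (ψ : ℝ × α → ℝ) (z : ℝ × α) : ℝ :=
  Filter.limsup (fun y => max (ψ z - ψ (z.1, y)) 0 / ρ z.2 y) (nhdsWithin z.2 (s \ {z.2}))

/-- Product (max) metric on `ℝ × α` built from `ρ`. -/
def prodMet {α : Type*} (ρ : α → α → ℝ) : ℝ × α → ℝ × α → ℝ :=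
  fun z w => max |z.1 - w.1| (ρ z.2 w.2)

/-- Metric viscosity subsolution of `∂ₜ u + H(t, x, u, |∇u|) = 0` on `(0,∞) × (s, ρ)`. -/
def IsMVSubsolutionTWrt {α : Type*} [TopologicalSpace α] (s : Set α) (ρ : α → α → ℝ)
    (H : ℝ → α → ℝ → ℝ → ℝ) (u : ℝ × α → ℝ) : Prop :=
  ∀ ψ₁ ψ₂ dψ₁ dψ₂ : ℝ × α → ℝ,
    LocLipWrt (Ioi (0:ℝ) ×ˢ s) (prodMet ρ) ψ₁ →
    LocLipWrt (Ioi (0:ℝ) ×ˢ s) (prodMet ρ) ψ₂ →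
    (∀ z ∈ Ioi (0:ℝ) ×ˢ s, HasDerivAt (fun τ => ψ₁ (τ, z.2)) (dψ₁ z) z.1) →
    ContinuousOn dψ₁ (Ioi (0:ℝ) ×ˢ s) →
    (∀ z ∈ Ioi (0:ℝ) ×ˢ s, HasDerivAt (fun τ => ψ₂ (τ, z.2)) (dψ₂ z) z.1) →
    ContinuousOn dψ₂ (Ioi (0:ℝ) ×ˢ s) →
    ContinuousOn (slopeSpWrt s ρ ψ₁) (Ioi (0:ℝ) ×ˢ s) →
    (∀ z ∈ Ioi (0:ℝ) ×ˢ s, lowerSlopeSpWrt s ρ ψ₁ z = slopeSpWrt s ρ ψ₁ z) →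
    ∀ z ∈ Ioi (0:ℝ) ×ˢ s,
      IsLocalMaxOn (fun w => uscWrt (Ioi (0:ℝ) ×ˢ s) u w - (ψ₁ w + ψ₂ w))
        (Ioi (0:ℝ) ×ˢ s) z →
      dψ₁ z + dψ₂ z +
        Hlow (fun w : ℝ × α => H w.1 w.2)
          (uscWrt (Ioi (0:ℝ) ×ˢ s) (slopeSpWrt s ρ ψ₂) z) z
          (uscWrt (Ioi (0:ℝ) ×ˢ s) u z) (slopeSpWrt s ρ ψ₁ z) ≤ 0

/-- Metric viscosity supersolution of `∂ₜ u + H(t, x, u, |∇u|) = 0` on `(0,∞) × (s, ρ)`. -/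
def IsMVSupersolutionTWrt {α : Type*} [TopologicalSpace α] (s : Set α) (ρ : α → α → ℝ)
    (H : ℝ → α → ℝ → ℝ → ℝ) (u : ℝ × α → ℝ) : Prop :=
  ∀ ψ₁ ψ₂ dψ₁ dψ₂ : ℝ × α → ℝ,
    LocLipWrt (Ioi (0:ℝ) ×ˢ s) (prodMet ρ) ψ₁ →
    LocLipWrt (Ioi (0:ℝ) ×ˢ s) (prodMet ρ) ψ₂ →
    (∀ z ∈ Ioi (0:ℝ) ×ˢ s, HasDerivAt (fun τ => ψ₁ (τ, z.2)) (dψ₁ z) z.1) →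
    ContinuousOn dψ₁ (Ioi (0:ℝ) ×ˢ s) →
    (∀ z ∈ Ioi (0:ℝ) ×ˢ s, HasDerivAt (fun τ => ψ₂ (τ, z.2)) (dψ₂ z) z.1) →
    ContinuousOn dψ₂ (Ioi (0:ℝ) ×ˢ s) →
    ContinuousOn (slopeSpWrt s ρ ψ₁) (Ioi (0:ℝ) ×ˢ s) →
    (∀ z ∈ Ioi (0:ℝ) ×ˢ s, upperSlopeSpWrt s ρ ψ₁ z = slopeSpWrt s ρ ψ₁ z) →
    ∀ z ∈ Ioi (0:ℝ) ×ˢ s,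
      IsLocalMinOn (fun w => lscWrt (Ioi (0:ℝ) ×ˢ s) u w - (ψ₁ w + ψ₂ w))
        (Ioi (0:ℝ) ×ˢ s) z →
      0 ≤ dψ₁ z + dψ₂ z +
        Hupp (fun w : ℝ × α => H w.1 w.2)
          (uscWrt (Ioi (0:ℝ) ×ˢ s) (slopeSpWrt s ρ ψ₂) z) z
          (lscWrt (Ioi (0:ℝ) ×ˢ s) u z) (slopeSpWrt s ρ ψ₁ z)

theorem limsup_le_of_nonneg {α : Type*} {F : Filter α} {f : α → ℝ} {b : ℝ} (hb : 0 ≤ b)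
    (h0 : ∀ᶠ z in F, 0 ≤ f z) (h : ∀ᶠ z in F, f z ≤ b) : limsup f F ≤ b := by
  rcases F.eq_or_neBot with rfl | _
  · simpa [limsup_eq] using hb
  · exact limsup_le_of_le (isCoboundedUnder_le_of_eventually_le F h0) h

theorem limsup_nonneg_of_eventually_nonneg {α : Type*} {F : Filter α} {f : α → ℝ}
    (h0 : ∀ᶠ z in F, 0 ≤ f z) (hf : IsBoundedUnder (· ≤ ·) F f) : 0 ≤ limsup f F := by
  rcases F.eq_or_neBot with rfl | _
  · simp [limsup_eq]
  · exact le_limsup_of_frequently_le h0.frequently hf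

section MetricOn

variable {Y : Type*} [MetricSpace Y] {S : Set Y} {ρ : Y → Y → ℝ} {x y z : Y} {f : Y → ℝ}

theorem IsMetricOn.nonneg (h : IsMetricOn S ρ) (hx : x ∈ S) (hy : y ∈ S) : 0 ≤ ρ x y :=
  dist_nonneg.trans (h.ge_dist x hx y hy)

theorem IsMetricOn.pos (h : IsMetricOn S ρ) (hx : x ∈ S) (hy : y ∈ S) (hxy : x ≠ y) :
    0 < ρ x y :=
  (dist_pos.2 hxy).trans_le (h.ge_dist x hx y hy)

theorem IsMetricOn.abs_sub_le (h : IsMetricOn S ρ) (hx : x ∈ S) (hy : y ∈ S) (hz : z ∈ S) :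
    |ρ x z - ρ y z| ≤ ρ x y := by
  have h₁ := h.triangle x hx y hy z hz
  have h₂ := h.triangle y hy x hx z hz
  rw [h.symm y hy x hx] at h₂
  exact abs_le.2 ⟨by linarith, by linarith⟩

theorem IsMetricOn.eventually_lt (h : IsMetricOn S ρ) (hx : x ∈ S) {ε : ℝ} (hε : 0 < ε) :
    ∀ᶠ y in 𝓝[S] x, y ∈ S ∧ ρ x y < ε :=
  (h.nhds_basis x hx).mem_of_mem hε

theorem IsMetricOn.continuousOn (h : IsMetricOn S ρ) :
    ContinuousOn (fun p : Y × Y => ρ p.1 p.2) (S ×ˢ S) := by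
  rintro ⟨x, y⟩ ⟨hx, hy⟩
  rw [ContinuousWithinAt, nhdsWithin_prod_eq, Metric.tendsto_nhds]
  intro ε hε
  filter_upwards [(h.eventually_lt hx (half_pos hε)).prod_mk (h.eventually_lt hy (half_pos hε))]
  rintro ⟨a, b⟩ ⟨⟨ha, hxa⟩, hb, hyb⟩
  simp only at ha hxa hb hyb hx hy ⊢
  have h₁ := h.abs_sub_le hx ha hy
  have h₂ := h.abs_sub_le hy hb ha
  rw [h.symm y hy a ha, h.symm b hb a ha] at h₂
  rw [abs_le] at h₁ h₂
  rw [Real.dist_eq, abs_lt]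
  constructor <;> linarith

theorem nhdsWithin_diff_singleton_le : 𝓝[S \ {x}] x ≤ 𝓝[S] x :=
  nhdsWithin_mono x sdiff_subset

theorem eventually_diff_singleton (S : Set Y) (x : Y) : ∀ᶠ z in 𝓝[S \ {x}] x, z ∈ S ∧ z ≠ x :=
  self_mem_nhdsWithin

theorem IsMetricOn.frequently_between (h : IsMetricOn S ρ) (hg : IsGeodesicWrt S ρ)
    (hx : x ∈ S) (hy : y ∈ S) (hxy : x ≠ y) :
    ∃ᶠ z in 𝓝[S \ {x}] x, ρ z y + ρ x z = ρ x y := by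
  have hD := h.pos hx hy hxy
  rw [frequently_iff]
  intro U hU
  obtain ⟨γ, h0, h1, hγS, hγ⟩ := hg x hx y hy
  have hU' : ∀ᶠ z in 𝓝[S] x, z ≠ x → z ∈ U := by
    have : 𝓝[S \ {x}] x = 𝓝[S] x ⊓ 𝓟 {x}ᶜ := by
      rw [sdiff_eq, nhdsWithin_inter']
    rw [this, mem_inf_principal] at hU
    exact hU
  obtain ⟨ε, hε, hεU⟩ := (h.nhds_basis x hx).eventually_iff.1 hU'
  have ht0 : 0 < min (ρ x y) (ε / 2) := lt_min hD (half_pos hε)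
  have htD : min (ρ x y) (ε / 2) ≤ ρ x y := min_le_left _ _
  have htε : min (ρ x y) (ε / 2) < ε := (min_le_right _ _).trans_lt (half_lt_self hε)
  generalize min (ρ x y) (ε / 2) = t at ht0 htD htε
  have e₁ : ρ x (γ t) = t := by
    have := hγ 0 ⟨le_rfl, hD.le⟩ t ⟨ht0.le, htD⟩
    rwa [h0, zero_sub, abs_neg, abs_of_pos ht0] at this
  have e₂ : ρ (γ t) y = ρ x y - t := by
    have := hγ t ⟨ht0.le, htD⟩ _ ⟨hD.le, le_rfl⟩
    rwa [h1, abs_sub_comm, abs_of_nonneg (sub_nonneg.2 htD)] at this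
  refine ⟨γ t, hεU ⟨hγS t ⟨ht0.le, htD⟩, e₁.trans_lt htε⟩ ?_, by rw [e₁, e₂]; ring⟩
  intro hc
  rw [hc, h.refl x hx] at e₁
  exact ht0.ne e₁

theorem LocLipWrt.exists_nonneg (h : IsMetricOn S ρ) (hf : LocLipWrt S ρ f) (hx : x ∈ S) :
    ∃ K : ℝ, 0 ≤ K ∧ ∃ ε : ℝ, 0 < ε ∧ ∀ y ∈ S, ρ x y < ε → ∀ z ∈ S, ρ x z < ε →
      |f y - f z| ≤ K * ρ y z := by
  obtain ⟨K, t, ht, hK⟩ := hf x hx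
  obtain ⟨ε, hε, hεt⟩ := (h.nhds_basis x hx).mem_iff.1 ht
  refine ⟨|K|, abs_nonneg K, ε, hε, fun y hy hxy z hz hxz => ?_⟩
  exact (hK y ⟨hεt ⟨hy, hxy⟩, hy⟩ z ⟨hεt ⟨hz, hxz⟩, hz⟩).trans
    (mul_le_mul_of_nonneg_right (le_abs_self K) (h.nonneg hy hz))

theorem LocLipWrt.add {g : Y → ℝ} (hf : LocLipWrt S ρ f)
    (hg : LocLipWrt S ρ g) : LocLipWrt S ρ (fun y => f y + g y) := by
  intro x hx
  obtain ⟨K, t, ht, hK⟩ := hf x hx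
  obtain ⟨L, s, hs, hL⟩ := hg x hx
  refine ⟨K + L, t ∩ s, inter_mem ht hs, fun y hy z hz => ?_⟩
  have h₁ := hK y ⟨hy.1.1, hy.2⟩ z ⟨hz.1.1, hz.2⟩
  have h₂ := hL y ⟨hy.1.2, hy.2⟩ z ⟨hz.1.2, hz.2⟩
  rw [abs_le] at h₁ h₂ ⊢
  constructor <;> linarith

theorem LocLipWrt.continuousOn (h : IsMetricOn S ρ) (hf : LocLipWrt S ρ f) :
    ContinuousOn f S := by
  intro x hx
  obtain ⟨K, hK, ε, hε, hKε⟩ := hf.exists_nonneg h hx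
  rw [ContinuousWithinAt, Metric.tendsto_nhds]
  intro δ hδ
  have hKδ : 0 < δ / (K + 1) := by positivity
  filter_upwards [h.eventually_lt hx hε, h.eventually_lt hx hKδ] with y hy hy'
  have h₁ := hKε y hy.1 hy.2 x hx (by rwa [h.refl x hx])
  rw [lt_div_iff₀ (by positivity)] at hy'
  rw [h.symm y hy.1 x hx] at h₁
  have := h.nonneg hx hy.1
  rw [Real.dist_eq]
  nlinarith [hy'.2]

theorem LocLipWrt.eventually_slopeWrt_le (h : IsMetricOn S ρ) (hf : LocLipWrt S ρ f)
    (hx : x ∈ S) : ∃ K : ℝ, 0 ≤ K ∧ ∀ᶠ y in 𝓝[S] x,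
      (∀ᶠ z in 𝓝[S \ {y}] y, |f z - f y| / ρ y z ≤ K) ∧ slopeWrt S ρ f y ≤ K := by
  obtain ⟨K, hK, ε, hε, hKε⟩ := hf.exists_nonneg h hx
  refine ⟨K, hK, ?_⟩
  filter_upwards [h.eventually_lt hx hε] with y hy
  have key : ∀ᶠ z in 𝓝[S \ {y}] y, |f z - f y| / ρ y z ≤ K := by
    filter_upwards [nhdsWithin_diff_singleton_le (h.eventually_lt hy.1 (sub_pos.2 hy.2)),
      eventually_diff_singleton S y] with z hz hz'
    rw [div_le_iff₀ (h.pos hy.1 hz.1 hz'.2.symm), h.symm y hy.1 z hz.1]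
    refine hKε z hz.1 ?_ y hy.1 hy.2
    have := h.triangle x hx y hy.1 z hz.1
    linarith [hz.2]
  refine ⟨key, limsup_le_of_nonneg hK ?_ key⟩
  filter_upwards [eventually_diff_singleton S y] with z hz
  exact div_nonneg (abs_nonneg _) (h.nonneg hy.1 hz.1)

theorem LocLipWrt.isBoundedUnder (h : IsMetricOn S ρ) (hf : LocLipWrt S ρ f) (hx : x ∈ S) :
    IsBoundedUnder (· ≤ ·) (𝓝[S \ {x}] x) (fun z => |f z - f x| / ρ x z) := by
  obtain ⟨K, -, hK⟩ := hf.eventually_slopeWrt_le h hx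
  exact isBoundedUnder_of_eventually_le (hK.self_of_nhdsWithin hx).1

theorem LocLipWrt.slopeWrt_nonneg (h : IsMetricOn S ρ) (hf : LocLipWrt S ρ f) (hx : x ∈ S) :
    0 ≤ slopeWrt S ρ f x := by
  refine limsup_nonneg_of_eventually_nonneg ?_ (hf.isBoundedUnder h hx)
  filter_upwards [eventually_diff_singleton S x] with z hz
  exact div_nonneg (abs_nonneg _) (h.nonneg hx hz.1)

theorem LocLipWrt.eventually_abs_sub_le (h : IsMetricOn S ρ) (hf : LocLipWrt S ρ f)
    (hx : x ∈ S) {ε : ℝ} (hε : 0 < ε) :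
    ∀ᶠ z in 𝓝[S \ {x}] x, |f z - f x| ≤ (slopeWrt S ρ f x + ε) * ρ x z := by
  filter_upwards [eventually_lt_of_limsup_lt (lt_add_of_pos_right (slopeWrt S ρ f x) hε)
    (hf.isBoundedUnder h hx), eventually_diff_singleton S x] with z hz hz'
  exact (div_le_iff₀ (h.pos hx hz'.1 hz'.2.symm)).1 hz.le

theorem IsMetricOn.abs_sq_sub_sq_le (h : IsMetricOn S ρ) (hx : x ∈ S) (hy : y ∈ S)
    (hz : z ∈ S) : |ρ z y ^ 2 - ρ x y ^ 2| ≤ ρ x z * (2 * ρ x y + ρ x z) := by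
  have h₁ := h.abs_sub_le hx hz hy
  have h₂ := h.nonneg hx hy
  have h₃ := h.nonneg hz hy
  have h₄ := h.nonneg hx hz
  have : ρ z y ^ 2 - ρ x y ^ 2 = (ρ z y - ρ x y) * (ρ z y + ρ x y) := by ring
  rw [this, abs_mul, abs_sub_comm, abs_of_nonneg (add_nonneg h₃ h₂)]
  have := abs_le.1 h₁
  exact mul_le_mul h₁ (by linarith) (by linarith) h₄

theorem IsMetricOn.slopes_neg_sq (h : IsMetricOn S ρ) (hg : IsGeodesicWrt S ρ) {c : ℝ}
    (hc : 0 < c) (hx : x ∈ S) (hy : y ∈ S) :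
    slopeWrt S ρ (fun z => -(c * ρ z y ^ 2)) x = 2 * c * ρ x y ∧
      upperSlopeWrt S ρ (fun z => -(c * ρ z y ^ 2)) x = 2 * c * ρ x y := by
  have hD := h.nonneg hx hy
  have habs : ∀ ε : ℝ, 0 < ε → ∀ᶠ z in 𝓝[S \ {x}] x,
      |-(c * ρ z y ^ 2) - -(c * ρ x y ^ 2)| / ρ x z ≤ 2 * c * ρ x y + ε := by
    intro ε hε
    filter_upwards [nhdsWithin_diff_singleton_le (h.eventually_lt hx (div_pos hε hc)),
      eventually_diff_singleton S x] with z hz hz'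
    have h₁ := h.abs_sq_sub_sq_le hx hy hz.1
    have h₂ := h.pos hx hz.1 hz'.2.symm
    rw [div_le_iff₀ h₂]
    have h₃ := (lt_div_iff₀ hc).1 hz.2
    have : -(c * ρ z y ^ 2) - -(c * ρ x y ^ 2) = -(c * (ρ z y ^ 2 - ρ x y ^ 2)) := by ring
    rw [this, abs_neg, abs_mul, abs_of_pos hc]
    calc c * |ρ z y ^ 2 - ρ x y ^ 2| ≤ c * (ρ x z * (2 * ρ x y + ρ x z)) := by gcongr
      _ = (2 * c * ρ x y + ρ x z * c) * ρ x z := by ring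
      _ ≤ _ := by gcongr
  have hmax : ∀ ε : ℝ, 0 < ε → ∀ᶠ z in 𝓝[S \ {x}] x,
      max (-(c * ρ z y ^ 2) - -(c * ρ x y ^ 2)) 0 / ρ x z ≤ 2 * c * ρ x y + ε := by
    intro ε hε
    filter_upwards [habs ε hε, eventually_diff_singleton S x] with z hz hz'
    refine le_trans ?_ hz
    have := h.nonneg hx hz'.1
    gcongr
    exact max_le (le_abs_self _) (abs_nonneg _)
  have hfreq : x ≠ y → ∀ ε : ℝ, 0 < ε → ∃ᶠ z in 𝓝[S \ {x}] x,
      2 * c * ρ x y - ε ≤ (-(c * ρ z y ^ 2) - -(c * ρ x y ^ 2)) / ρ x z := by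
    intro hxy ε hε
    refine ((h.frequently_between hg hx hy hxy).and_eventually
      (((h.eventually_lt hx (div_pos hε hc)).filter_mono nhdsWithin_diff_singleton_le).and
        (eventually_diff_singleton S x))).mono ?_
    rintro z ⟨hz, hz', hz''⟩
    have h₂ := h.pos hx hz'.1 hz''.2.symm
    have h₃ := (lt_div_iff₀ hc).1 hz'.2
    rw [le_div_iff₀ h₂]
    have : ρ z y = ρ x y - ρ x z := by linarith
    rw [this]
    nlinarith
  have habs0 : ∀ᶠ z in 𝓝[S \ {x}] x, 0 ≤ |-(c * ρ z y ^ 2) - -(c * ρ x y ^ 2)| / ρ x z := by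
    filter_upwards [eventually_diff_singleton S x] with z hz
    exact div_nonneg (abs_nonneg _) (h.nonneg hx hz.1)
  have hmax0 : ∀ᶠ z in 𝓝[S \ {x}] x,
      0 ≤ max (-(c * ρ z y ^ 2) - -(c * ρ x y ^ 2)) 0 / ρ x z := by
    filter_upwards [eventually_diff_singleton S x] with z hz
    exact div_nonneg (le_max_right _ _) (h.nonneg hx hz.1)
  have hbabs := isBoundedUnder_of_eventually_le (habs 1 one_pos)
  have hbmax := isBoundedUnder_of_eventually_le (hmax 1 one_pos)
  constructor
  · refine le_antisymm (le_of_forall_pos_le_add fun ε hε =>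
      limsup_le_of_nonneg (by positivity) habs0 (habs ε hε)) ?_
    by_cases hxy : x = y
    · have h0 : ρ x y = 0 := by rw [hxy, h.refl y hy]
      rw [h0, mul_zero]
      exact limsup_nonneg_of_eventually_nonneg habs0 hbabs
    · refine le_of_forall_pos_le_add fun ε hε => sub_le_iff_le_add.1 ?_
      refine le_limsup_of_frequently_le (((hfreq hxy ε hε).and_eventually
        (eventually_diff_singleton S x)).mono fun z hz => hz.1.trans ?_) hbabs
      have := h.nonneg hx hz.2.1
      gcongr
      exact le_abs_self _
  · refine le_antisymm (le_of_forall_pos_le_add fun ε hε =>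
      limsup_le_of_nonneg (by positivity) hmax0 (hmax ε hε)) ?_
    by_cases hxy : x = y
    · have h0 : ρ x y = 0 := by rw [hxy, h.refl y hy]
      rw [h0, mul_zero]
      exact limsup_nonneg_of_eventually_nonneg hmax0 hbmax
    · refine le_of_forall_pos_le_add fun ε hε => sub_le_iff_le_add.1 ?_
      refine le_limsup_of_frequently_le (((hfreq hxy ε hε).and_eventually
        (eventually_diff_singleton S x)).mono fun z hz => hz.1.trans ?_) hbmax
      have := h.nonneg hx hz.2.1
      gcongr
      exact le_max_left _ _

theorem IsMetricOn.isC1PlusWrt_neg_sq (h : IsMetricOn S ρ) (hg : IsGeodesicWrt S ρ) {c : ℝ}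
    (hc : 0 < c) (hy : y ∈ S) : IsC1PlusWrt S ρ (fun z => -(c * ρ z y ^ 2)) := by
  refine ⟨fun x hx => ⟨c * (2 * (ρ x y + 1)), _, h.eventually_lt hx one_pos, ?_⟩, ?_, ?_⟩
  · rintro a ⟨⟨ha, hxa⟩, -⟩ b ⟨⟨hb, hxb⟩, -⟩
    have h₁ := abs_le.1 (h.abs_sub_le ha hb hy)
    have h₂ := abs_le.1 (h.abs_sub_le hx ha hy)
    have h₃ := abs_le.1 (h.abs_sub_le hx hb hy)
    have h₄ := h.nonneg ha hy
    have h₅ := h.nonneg hb hy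
    have e : -(c * ρ a y ^ 2) - -(c * ρ b y ^ 2)
        = -(c * ((ρ a y + ρ b y) * (ρ a y - ρ b y))) := by ring
    rw [e, abs_neg, abs_mul, abs_mul, abs_of_pos hc, abs_of_nonneg (add_nonneg h₄ h₅),
      mul_assoc]
    gcongr
    · linarith [h.nonneg hx hy]
    · linarith
    · exact h.abs_sub_le ha hb hy
  · refine ContinuousOn.congr ?_ fun x hx => (h.slopes_neg_sq hg hc hx hy).1
    exact continuousOn_const.mul
      (h.continuousOn.comp (continuousOn_id.prodMk continuousOn_const) fun x hx => ⟨hx, hy⟩)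
  · intro x hx
    rw [(h.slopes_neg_sq hg hc hx hy).1, (h.slopes_neg_sq hg hc hx hy).2]

theorem IsMVSupersolutionWrt.nonneg_of_isMinOn {H : Y → ℝ → ℝ → ℝ} {u : Y → ℝ}
    (hu : IsMVSupersolutionWrt S ρ H u) (h : IsMetricOn S ρ) (hg : IsGeodesicWrt S ρ) {c : ℝ}
    (hc : 0 < c) (hx : x ∈ S) (hy : y ∈ S)
    (hmin : IsMinOn (fun z => lscWrt S u z + c * ρ z y ^ 2) S x) :
    0 ≤ H x (lscWrt S u x) (2 * c * ρ x y) := by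
  have hne : (𝓝[S] x).NeBot := mem_closure_iff_nhdsWithin_neBot.1 (subset_closure hx)
  have h0 : LocLipWrt S ρ (fun _ => (0 : ℝ)) := fun x _ =>
    ⟨0, univ, univ_mem, fun y _ z _ => by simp⟩
  have hs : slopeWrt S ρ (fun _ => (0 : ℝ)) = fun _ => 0 := by
    funext z
    refine le_antisymm (limsup_le_of_nonneg le_rfl (by simp) (by simp))
      (limsup_nonneg_of_eventually_nonneg (by simp) ?_)
    exact isBoundedUnder_of_eventually_le (a := 0) (by simp)
  have := hu _ _ (h.isC1PlusWrt_neg_sq hg hc hy) h0 x hx (by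
    refine IsMinOn.localize fun z hz => ?_
    simpa using hmin hz)
  have hset : {q : ℝ | 0 ≤ q ∧ |q - 2 * c * ρ x y| ≤ 0} = {2 * c * ρ x y} := by
    ext q
    have := h.nonneg hx hy
    simp only [abs_nonpos_iff, sub_eq_zero, mem_ofPred_eq, mem_singleton_iff,
      and_iff_right_iff_imp]
    rintro rfl
    positivity
  rwa [hs, (h.slopes_neg_sq hg hc hx hy).1, uscWrt, limsup_const, Hupp, hset, image_singleton,
    csSup_singleton] at this

theorem IsMetricOn.abs_sub_slopeWrt_le (h : IsMetricOn S ρ) (hg : IsGeodesicWrt S ρ)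
    {ψ₁ ψ₂ : Y → ℝ} (h₁ : IsC1PlusWrt S ρ ψ₁) (h₂ : LocLipWrt S ρ ψ₂) {o : Y} {c : ℝ}
    (hc : 0 < c) (ho : o ∈ S) (hx : x ∈ S) (hy : y ∈ S)
    (hmax : IsLocalMaxOn (fun z => ψ₁ z + ψ₂ z - ρ z o ^ 2 - c * ρ z x ^ 2) S y) :
    |2 * c * ρ y x - slopeWrt S ρ ψ₁ y| ≤ slopeWrt S ρ ψ₂ y + 2 * ρ y o := by
  have hs₁ := h₁.1.slopeWrt_nonneg h hy
  have hs₂ := h₂.slopeWrt_nonneg h hy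
  have hyx := h.nonneg hy hx
  have hyo := h.nonneg hy ho
  have hmax' : ∀ᶠ z in 𝓝[S \ {y}] y, ψ₁ z + ψ₂ z - ρ z o ^ 2 - c * ρ z x ^ 2 ≤
      ψ₁ y + ψ₂ y - ρ y o ^ 2 - c * ρ y x ^ 2 :=
    nhdsWithin_diff_singleton_le hmax
  have hlt : ∀ ε : ℝ, 0 < ε → ∀ᶠ z in 𝓝[S \ {y}] y, z ∈ S ∧ ρ y z < ε := fun ε hε =>
    nhdsWithin_diff_singleton_le (h.eventually_lt hy hε)
  rw [abs_le]
  constructor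
  · suffices slopeWrt S ρ ψ₁ y ≤ slopeWrt S ρ ψ₂ y + 2 * ρ y o + 2 * c * ρ y x by linarith
    rw [← h₁.2.2 y hy]
    refine le_of_forall_pos_le_add fun ε hε => ?_
    refine limsup_le_of_nonneg (by positivity) ?_ ?_
    · filter_upwards [eventually_diff_singleton S y] with z hz
      exact div_nonneg (le_max_right _ _) (h.nonneg hy hz.1)
    · have hδ : 0 < ε / (2 + c) := by positivity
      filter_upwards [h₂.eventually_abs_sub_le h hy hδ, hmax', hlt _ hδ,
        eventually_diff_singleton S y] with z hz₂ hzm hzl hz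
      have hp := h.pos hy hz.1 hz.2.symm
      have ho' := (abs_le.1 (h.abs_sq_sub_sq_le hy ho hz.1)).2
      have hx' := (abs_le.1 (h.abs_sq_sub_sq_le hy hx hz.1)).2
      have hz₂' := (abs_le.1 hz₂).1
      have e : ε = 2 * (ε / (2 + c)) + c * (ε / (2 + c)) := by field_simp
      generalize ε / (2 + c) = δ at *
      subst e
      rw [div_le_iff₀ hp]
      refine max_le ?_ (by positivity)
      have hcx := mul_le_mul_of_nonneg_left hx' hc.le
      have hq : ρ y z * ρ y z ≤ δ * ρ y z := by gcongr; exact hzl.2.le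
      have hq' := mul_le_mul_of_nonneg_left hq hc.le
      nlinarith
  · suffices 2 * c * ρ y x ≤ slopeWrt S ρ ψ₁ y + slopeWrt S ρ ψ₂ y + 2 * ρ y o by linarith
    by_cases hyx' : y = x
    · rw [← hyx', h.refl y hy, mul_zero]
      positivity
    refine le_of_forall_pos_le_add fun ε hε => ?_
    have hδ : 0 < ε / (3 + c) := by positivity
    obtain ⟨z, hzb, hz₁, hz₂, hzm, hzl, hz⟩ := ((h.frequently_between hg hy hx hyx').and_eventually
      ((h₁.1.eventually_abs_sub_le h hy hδ).and ((h₂.eventually_abs_sub_le h hy hδ).and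
        (hmax'.and ((hlt _ hδ).and (eventually_diff_singleton S y)))))).exists
    have hp := h.pos hy hz.1 hz.2.symm
    have ho' := (abs_le.1 (h.abs_sq_sub_sq_le hy ho hz.1)).1
    have hz₂' := (abs_le.1 hz₂).1
    have hz₁' := (abs_le.1 hz₁).1
    have e : ε = 3 * (ε / (3 + c)) + c * (ε / (3 + c)) := by field_simp
    generalize ε / (3 + c) = δ at *
    subst e
    have e' : ρ z x = ρ y x - ρ y z := by linarith
    rw [e'] at hzm
    have hq : ρ y z * ρ y z ≤ δ * ρ y z := by gcongr; exact hzl.2.le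
    have hq' := mul_le_mul_of_nonneg_left hq hc.le
    refine le_of_mul_le_mul_right ?_ hp
    have ho'' := (abs_le.1 (h.abs_sq_sub_sq_le hy ho hz.1)).2
    nlinarith

end MetricOn

theorem exists_tendsto_extending {α : Type*} [TopologicalSpace α] {φ : ℕ → ℕ}
    (hφ : StrictMono φ) {f g : ℕ → α} {l : α} (hf : Tendsto f atTop (𝓝 l))
    (hg : Tendsto g atTop (𝓝 l)) {A : ℕ → Set α} (hfA : ∀ j, f j ∈ A (φ j))
    (hgA : ∀ n, g n ∈ A n) :
    ∃ e : ℕ → α, (∀ n, e n ∈ A n) ∧ Tendsto e atTop (𝓝 l) ∧ ∀ j, e (φ j) = f j := by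
  classical
  have he : ∀ n, ∃ a ∈ A n, (∀ j, φ j = n → a = f j) ∧ ((∃ j, φ j = n) ∨ a = g n) := by
    intro n
    by_cases hn : ∃ j, φ j = n
    · obtain ⟨j, rfl⟩ := hn
      exact ⟨f j, hfA j, fun i hi => by rw [hφ.injective hi], Or.inl ⟨j, rfl⟩⟩
    · exact ⟨g n, hgA n, fun j hj => absurd ⟨j, hj⟩ hn, Or.inr rfl⟩
  choose e heA hef heg using he
  refine ⟨e, heA, ?_, fun j => hef _ j rfl⟩
  intro U hU
  obtain ⟨N₁, hN₁⟩ := eventually_atTop.1 (hf.eventually hU)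
  obtain ⟨N₂, hN₂⟩ := eventually_atTop.1 (hg.eventually hU)
  refine eventually_atTop.2 ⟨max (φ N₁) N₂, fun n hn => ?_⟩
  rcases heg n with ⟨j, rfl⟩ | h
  · rw [hef _ j rfl]
    exact hN₁ j (hφ.le_iff_le.1 ((le_max_left _ _).trans hn))
  · rw [h]
    exact hN₂ n ((le_max_right _ _).trans hn)

theorem isBoundedUnder_ge_of_abs_le {Y : Type*} {X : ℕ → Set Y} {u : ℕ → Y → ℝ} {C : ℝ}
    (hC : ∀ n, ∀ x ∈ X n, |u n x| ≤ C) {f : ℕ → Y}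
    (hf : ∀ n, f n ∈ X n) : IsBoundedUnder (· ≥ ·) atTop fun n => u n (f n) :=
  isBoundedUnder_of_eventually_ge (Eventually.of_forall fun n => (abs_le.1 (hC n _ (hf n))).1)

theorem isCoboundedUnder_ge_of_abs_le {Y : Type*} {X : ℕ → Set Y} {u : ℕ → Y → ℝ} {C : ℝ}
    (hC : ∀ n, ∀ x ∈ X n, |u n x| ≤ C) {f : ℕ → Y}
    (hf : ∀ n, f n ∈ X n) : IsCoboundedUnder (· ≥ ·) atTop fun n => u n (f n) :=
  isCoboundedUnder_ge_of_eventually_le atTop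
    (Eventually.of_forall fun n => (abs_le.1 (hC n _ (hf n))).2)

section Hausdorff

variable {Y : Type*} [MetricSpace Y] {X : ℕ → Set Y} {Xi : Set Y}

theorem exists_tendsto_of_tendsto_hausdorffDist (hXne : ∀ n, (X n).Nonempty)
    (hXc : ∀ n, IsCompact (X n)) (hXic : IsCompact Xi)
    (h1 : Tendsto (fun n => hausdorffDist (X n) Xi) atTop (𝓝 0)) {x : Y} (hx : x ∈ Xi) :
    ∃ g : ℕ → Y, (∀ n, g n ∈ X n) ∧ Tendsto g atTop (𝓝 x) := by
  choose g hg hgd using fun n => (hXc n).exists_infDist_eq_dist (hXne n) x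
  refine ⟨g, hg, tendsto_iff_dist_tendsto_zero.2 ?_⟩
  refine squeeze_zero (fun _ => dist_nonneg) (fun n => ?_) h1
  rw [dist_comm, ← hgd n, hausdorffDist_comm]
  exact infDist_le_hausdorffDist_of_mem hx (hausdorffEDist_ne_top_of_nonempty_of_bounded
    ⟨x, hx⟩ (hXne n) hXic.isBounded (hXc n).isBounded)

theorem exists_subseq_tendsto_of_tendsto_hausdorffDist
    (hXc : ∀ n, IsCompact (X n)) (hXine : Xi.Nonempty) (hXic : IsCompact Xi)
    (h1 : Tendsto (fun n => hausdorffDist (X n) Xi) atTop (𝓝 0)) {φ : ℕ → ℕ}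
    (hφ : StrictMono φ) {f : ℕ → Y} (hf : ∀ j, f j ∈ X (φ j)) :
    ∃ x ∈ Xi, ∃ ψ : ℕ → ℕ, StrictMono ψ ∧ Tendsto (fun j => f (ψ j)) atTop (𝓝 x) := by
  choose g hg hgd using fun j => hXic.exists_infDist_eq_dist hXine (f j)
  obtain ⟨x, hx, ψ, hψ, hlim⟩ := hXic.tendsto_subseq hg
  refine ⟨x, hx, ψ, hψ, ?_⟩
  have hd : Tendsto (fun j => dist (f j) (g j)) atTop (𝓝 0) := by
    refine squeeze_zero (fun _ => dist_nonneg) (fun j => ?_) (h1.comp hφ.tendsto_atTop)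
    rw [← hgd j]
    exact infDist_le_hausdorffDist_of_mem (hf j) (hausdorffEDist_ne_top_of_nonempty_of_bounded
      ⟨_, hf j⟩ hXine (hXc _).isBounded hXic.isBounded)
  refine tendsto_iff_dist_tendsto_zero.2 ?_
  have := (hd.comp hψ.tendsto_atTop).add (tendsto_iff_dist_tendsto_zero.1 hlim)
  rw [add_zero] at this
  exact squeeze_zero (fun _ => dist_nonneg) (fun j => dist_triangle _ (g (ψ j)) _) this

/-- The lower semilimit of the functions `u n` on the sets `X n`. -/
noncomputable def lowerSemilimit (X : ℕ → Set Y) (u : ℕ → Y → ℝ) (x : Y) : ℝ :=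
  sInf {L : ℝ | ∃ xn : ℕ → Y, (∀ n, xn n ∈ X n) ∧ Tendsto xn atTop (𝓝 x) ∧
    liminf (fun n => u n (xn n)) atTop = L}

variable {u : ℕ → Y → ℝ} {C : ℝ} {x : Y}

theorem lowerSemilimit_le_of_frequently_le (hC : ∀ n, ∀ x ∈ X n, |u n x| ≤ C) {f : ℕ → Y}
    (hf : ∀ n, f n ∈ X n) (hfx : Tendsto f atTop (𝓝 x)) {c : ℝ}
    (hc : ∃ᶠ n in atTop, u n (f n) ≤ c) : lowerSemilimit X u x ≤ c := by
  refine le_trans (csInf_le ⟨-C, ?_⟩ ⟨f, hf, hfx, rfl⟩)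
    (liminf_le_of_frequently_le hc (isBoundedUnder_ge_of_abs_le hC hf))
  rintro L ⟨g, hg, -, rfl⟩
  exact le_liminf_of_le (isCoboundedUnder_ge_of_abs_le hC hg)
    (Eventually.of_forall fun n => (abs_le.1 (hC n _ (hg n))).1)

theorem le_lowerSemilimit (hC : ∀ n, ∀ x ∈ X n, |u n x| ≤ C)
    (hx : ∃ g : ℕ → Y, (∀ n, g n ∈ X n) ∧ Tendsto g atTop (𝓝 x)) {c : ℝ}
    (hc : ∀ f : ℕ → Y, (∀ n, f n ∈ X n) → Tendsto f atTop (𝓝 x) →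
      ∀ᶠ n in atTop, c ≤ u n (f n)) : c ≤ lowerSemilimit X u x := by
  obtain ⟨g, hg, hgx⟩ := hx
  refine le_csInf ⟨_, g, hg, hgx, rfl⟩ ?_
  rintro L ⟨f, hf, hfx, rfl⟩
  exact le_liminf_of_le (isCoboundedUnder_ge_of_abs_le hC hf) (hc f hf hfx)

theorem abs_lowerSemilimit_le (hC : ∀ n, ∀ x ∈ X n, |u n x| ≤ C)
    (hx : ∃ g : ℕ → Y, (∀ n, g n ∈ X n) ∧ Tendsto g atTop (𝓝 x)) :
    |lowerSemilimit X u x| ≤ C := by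
  refine abs_le.2 ⟨le_lowerSemilimit hC hx fun f hf _ =>
    Eventually.of_forall fun n => (abs_le.1 (hC n _ (hf n))).1, ?_⟩
  obtain ⟨g, hg, hgx⟩ := hx
  exact lowerSemilimit_le_of_frequently_le hC hg hgx
    (Eventually.of_forall fun n => (abs_le.1 (hC n _ (hg n))).2).frequently

theorem tendsto_of_dist_lt_inv {f : ℕ → Y} (h : ∀ j : ℕ, dist (f j) x < 1 / ((j : ℝ) + 1)) :
    Tendsto f atTop (𝓝 x) :=
  tendsto_iff_dist_tendsto_zero.2 (squeeze_zero (fun _ => dist_nonneg) (fun j => (h j).le)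
    tendsto_one_div_add_atTop_nhds_zero_nat)

theorem exists_forall_le_of_lt_lowerSemilimit (hC : ∀ n, ∀ x ∈ X n, |u n x| ≤ C)
    (hx : ∃ g : ℕ → Y, (∀ n, g n ∈ X n) ∧ Tendsto g atTop (𝓝 x)) {c : ℝ}
    (hc : c < lowerSemilimit X u x) :
    ∃ δ > 0, ∀ᶠ n in atTop, ∀ z ∈ X n, dist z x < δ → c ≤ u n z := by
  by_contra! hcon
  obtain ⟨φ, hφ, h⟩ := extraction_forall_of_frequently
    (P := fun m n => ∃ z ∈ X n, dist z x < 1 / ((m : ℝ) + 1) ∧ u n z < c) fun m => by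
      exact hcon _ Nat.one_div_pos_of_nat
  choose f hfX hfd hfu using h
  obtain ⟨g, hg, hgx⟩ := hx
  obtain ⟨e, heX, hex, hef⟩ := exists_tendsto_extending hφ (tendsto_of_dist_lt_inv hfd) hgx hfX hg
  refine hc.not_ge (lowerSemilimit_le_of_frequently_le hC heX hex ?_)
  refine hφ.tendsto_atTop.frequently (p := fun n => u n (e n) ≤ c) (Frequently.of_forall fun j => ?_)
  rw [hef]
  exact (hfu j).le

theorem exists_subseq_le_lowerSemilimit (hC : ∀ n, ∀ x ∈ X n, |u n x| ≤ C)
    (hx : ∃ g : ℕ → Y, (∀ n, g n ∈ X n) ∧ Tendsto g atTop (𝓝 x)) :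
    ∃ φ : ℕ → ℕ, StrictMono φ ∧ ∃ f : ℕ → Y, (∀ j, f j ∈ X (φ j)) ∧ Tendsto f atTop (𝓝 x) ∧
      ∀ j : ℕ, u (φ j) (f j) ≤ lowerSemilimit X u x + 1 / ((j : ℝ) + 1) := by
  obtain ⟨φ, hφ, h⟩ := extraction_forall_of_frequently
    (P := fun m n => ∃ z ∈ X n, dist z x < 1 / ((m : ℝ) + 1) ∧
      u n z ≤ lowerSemilimit X u x + 1 / ((m : ℝ) + 1)) fun m => by
      by_contra hcon
      rw [not_frequently] at hcon
      have hm : (0 : ℝ) < 1 / ((m : ℝ) + 1) := Nat.one_div_pos_of_nat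
      refine (lt_add_of_pos_right (lowerSemilimit X u x) hm).not_ge
        (le_lowerSemilimit hC hx fun f hf hfx => ?_)
      filter_upwards [hcon, Metric.tendsto_nhds.1 hfx _ hm] with n hn hd
      by_contra! hlt
      exact hn ⟨f n, hf n, hd, hlt.le⟩
  choose f hfX hfd hfu using h
  exact ⟨φ, hφ, f, hfX, tendsto_of_dist_lt_inv hfd, hfu⟩

theorem lowerSemicontinuousOn_lowerSemilimit (hC : ∀ n, ∀ x ∈ X n, |u n x| ≤ C)
    (hX : ∀ x ∈ Xi, ∃ g : ℕ → Y, (∀ n, g n ∈ X n) ∧ Tendsto g atTop (𝓝 x)) :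
    LowerSemicontinuousOn (lowerSemilimit X u) Xi := by
  rw [lowerSemicontinuousOn_iff]
  intro x hx
  rw [lowerSemicontinuousWithinAt_iff]
  intro c hc
  obtain ⟨c', hcc', hc'⟩ := exists_between hc
  obtain ⟨δ, hδ, h⟩ := exists_forall_le_of_lt_lowerSemilimit hC (hX x hx) hc'
  filter_upwards [self_mem_nhdsWithin, nhdsWithin_le_nhds (ball_mem_nhds x hδ)] with y hy hyx
  refine hcc'.trans_le (le_lowerSemilimit hC (hX y hy) fun f hf hfy => ?_)
  filter_upwards [h, hfy.eventually (isOpen_ball.mem_nhds hyx)] with n hn hfn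
  exact hn _ (hf n) hfn

theorem lscWrt_le {S : Set Y} {w : Y → ℝ} (hC : ∀ x ∈ S, |w x| ≤ C) (hx : x ∈ S) :
    lscWrt S w x ≤ w x := by
  refine liminf_le_of_frequently_le (fun h => h.self_of_nhdsWithin hx le_rfl) ?_
  exact isBoundedUnder_of_eventually_ge (a := -C)
    (eventually_nhdsWithin_of_forall fun y hy => (abs_le.1 (hC y hy)).1)

theorem le_lscWrt {S : Set Y} {w : Y → ℝ} (hC : ∀ x ∈ S, |w x| ≤ C) (hx : x ∈ S) {c : ℝ}
    (hc : ∀ᶠ y in 𝓝[S] x, c ≤ w y) : c ≤ lscWrt S w x := by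
  have hne : (𝓝[S] x).NeBot := mem_closure_iff_nhdsWithin_neBot.1 (subset_closure hx)
  refine le_liminf_of_le ?_ hc
  exact isCoboundedUnder_ge_of_eventually_le (x := C) _
    (eventually_nhdsWithin_of_forall fun y hy => (abs_le.1 (hC y hy)).2)

theorem lowerSemicontinuousOn_lscWrt {S : Set Y} {w : Y → ℝ} (hC : ∀ x ∈ S, |w x| ≤ C) :
    LowerSemicontinuousOn (lscWrt S w) S := by
  rw [lowerSemicontinuousOn_iff]
  intro x hx
  rw [lowerSemicontinuousWithinAt_iff]
  intro c hc
  obtain ⟨c', hcc', hc'⟩ := exists_between hc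
  have h := eventually_lt_of_lt_liminf hc' (isBoundedUnder_of_eventually_ge (a := -C)
    (eventually_nhdsWithin_of_forall fun y hy => (abs_le.1 (hC y hy)).1))
  filter_upwards [eventually_eventually_nhdsWithin.2 h, self_mem_nhdsWithin] with y hy hyS
  exact hcc'.trans_le (le_lscWrt hC hyS (hy.mono fun z hz => hz.le))

theorem lscWrt_eq_of_lowerSemicontinuousOn {S : Set Y} {w : Y → ℝ}
    (hw : LowerSemicontinuousOn w S) (hC : ∀ x ∈ S, |w x| ≤ C) (hx : x ∈ S) :
    lscWrt S w x = w x := by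
  refine le_antisymm (lscWrt_le hC hx) (le_of_forall_lt fun c hc => ?_)
  obtain ⟨c', hcc', hc'⟩ := exists_between hc
  exact hcc'.trans_le (le_lscWrt hC hx
    ((lowerSemicontinuousWithinAt_iff.1 (lowerSemicontinuousOn_iff.1 hw x hx) c' hc').mono
      fun y hy => hy.le))

end Hausdorff

section Stability

variable {Y : Type*} [MetricSpace Y] {X : ℕ → Set Y} {Xi : Set Y} {d : ℕ → Y → Y → ℝ}
  {di : Y → Y → ℝ} {H : ℕ → Y → ℝ → ℝ → ℝ} {Hi : Y → ℝ → ℝ → ℝ} {u : ℕ → Y → ℝ} {C : ℝ}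

theorem exists_le_and_nonneg_of_isMinOn_lowerSemilimit
    (hXne : ∀ n, (X n).Nonempty) (hXc : ∀ n, IsCompact (X n)) (hXic : IsCompact Xi)
    (hmet : ∀ n, IsMetricOn (X n) (d n)) (hgeo : ∀ n, IsGeodesicWrt (X n) (d n))
    (hmeti : IsMetricOn Xi di)
    (h1 : Tendsto (fun n => hausdorffDist (X n) Xi) atTop (𝓝 0))
    (h2 : ∀ a ∈ Xi, ∀ b ∈ Xi, ∀ an bn : ℕ → Y, (∀ n, an n ∈ X n) → (∀ n, bn n ∈ X n) →
      Tendsto an atTop (𝓝 a) → Tendsto bn atTop (𝓝 b) →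
      Tendsto (fun n => d n (an n) (bn n)) atTop (𝓝 (di a b)))
    (h3 : ∀ x ∈ Xi, ∀ xn : ℕ → Y, (∀ n, xn n ∈ X n) → Tendsto xn atTop (𝓝 x) →
      ∀ r p : ℝ, 0 ≤ p → ∀ rn pn : ℕ → ℝ, (∀ n, 0 ≤ pn n) →
      Tendsto rn atTop (𝓝 r) → Tendsto pn atTop (𝓝 p) →
      Tendsto (fun n => H n (xn n) (rn n) (pn n)) atTop (𝓝 (Hi x r p)))
    (hsup : ∀ n, IsMVSupersolutionWrt (X n) (d n) (H n) (u n))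
    (hC : ∀ n, ∀ x ∈ X n, |u n x| ≤ C) {c : ℝ} (hc : 0 < c) {y z : Y} (hy : y ∈ Xi)
    (hz : z ∈ Xi) (hmin : IsMinOn (fun x => lowerSemilimit X u x + c * di x y ^ 2) Xi z) :
    ∃ x ∈ Xi, lowerSemilimit X u x + c * di x y ^ 2 ≤ lowerSemilimit X u z + c * di z y ^ 2 ∧
      0 ≤ Hi x (lowerSemilimit X u x) (2 * c * di x y) := by
  have hX : ∀ x ∈ Xi, ∃ g : ℕ → Y, (∀ n, g n ∈ X n) ∧ Tendsto g atTop (𝓝 x) := fun x hx =>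
    exists_tendsto_of_tendsto_hausdorffDist hXne hXc hXic h1 hx
  obtain ⟨yn, hynX, hyn⟩ := hX y hy
  have hex : ∀ n, ∃ x ∈ X n,
      IsMinOn (fun x => lscWrt (X n) (u n) x + c * d n x (yn n) ^ 2) (X n) x := fun n => by
    refine LowerSemicontinuousOn.exists_isMinOn (hXne n) (hXc n) ?_
    refine (lowerSemicontinuousOn_lscWrt (hC n)).add (ContinuousOn.lowerSemicontinuousOn ?_)
    exact continuousOn_const.mul (((hmet n).continuousOn.comp
      (continuousOn_id.prodMk continuousOn_const) fun x hx => ⟨hx, hynX n⟩).pow 2)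
  choose xn hxnX hxn using hex
  have hxnH := fun n => (hsup n).nonneg_of_isMinOn (hmet n) (hgeo n) hc (hxnX n) (hynX n) (hxn n)
  obtain ⟨φ, hφ, zn, hznX, hzn, hznu⟩ := exists_subseq_le_lowerSemilimit hC (hX z hz)
  obtain ⟨x, hx, ψ, hψ, hxlim⟩ := exists_subseq_tendsto_of_tendsto_hausdorffDist hXc ⟨y, hy⟩ hXic
    h1 hφ fun j => hxnX (φ j)
  have hσ : StrictMono fun j => φ (ψ j) := hφ.comp hψ
  have hdist : ∀ {a : Y}, a ∈ Xi → ∀ f : ℕ → Y, (∀ j, f j ∈ X (φ (ψ j))) →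
      Tendsto f atTop (𝓝 a) →
      Tendsto (fun j => d (φ (ψ j)) (f j) (yn (φ (ψ j)))) atTop (𝓝 (di a y)) := by
    intro a ha f hfX hfa
    obtain ⟨g, hgX, hga⟩ := hX a ha
    obtain ⟨e, heX, hea, hef⟩ := exists_tendsto_extending hσ hfa hga hfX hgX
    have := (h2 a ha y hy e yn heX hynX hea hyn).comp hσ.tendsto_atTop
    refine this.congr fun j => ?_
    simp only [Function.comp_apply, hef]
  have hdx := hdist hx _ (fun j => hxnX (φ (ψ j))) hxlim
  have hdz := hdist hz _ (fun j => hznX (ψ j)) (hzn.comp hψ.tendsto_atTop)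
  have hzx : lowerSemilimit X u z + c * di z y ^ 2 ≤ lowerSemilimit X u x + c * di x y ^ 2 :=
    hmin hx
  have hupper : ∀ j, lscWrt (X (φ (ψ j))) (u (φ (ψ j))) (xn (φ (ψ j))) ≤
      lowerSemilimit X u z + 1 / ((ψ j : ℝ) + 1)
        + c * d (φ (ψ j)) (zn (ψ j)) (yn (φ (ψ j))) ^ 2
        - c * d (φ (ψ j)) (xn (φ (ψ j))) (yn (φ (ψ j))) ^ 2 := by
    intro j
    have h₁ := hxn (φ (ψ j)) (hznX (ψ j))
    have h₂ := lscWrt_le (hC (φ (ψ j))) (hznX (ψ j))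
    have h₃ := hznu (ψ j)
    simp only [mem_ofPred_eq] at h₁
    linarith
  have hupper' := ((((tendsto_one_div_add_atTop_nhds_zero_nat (𝕜 := ℝ)).comp
    hψ.tendsto_atTop).const_add (lowerSemilimit X u z)).add ((hdz.pow 2).const_mul c)).sub
    ((hdx.pow 2).const_mul c)
  rw [add_zero] at hupper'
  have hlower : ∀ b < lowerSemilimit X u x,
      ∀ᶠ j in atTop, b ≤ lscWrt (X (φ (ψ j))) (u (φ (ψ j))) (xn (φ (ψ j))) := by
    intro b hb
    obtain ⟨δ, hδ, h⟩ := exists_forall_le_of_lt_lowerSemilimit hC (hX x hx) hb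
    filter_upwards [hσ.tendsto_atTop.eventually h, Metric.tendsto_nhds.1 hxlim δ hδ] with j hj hxj
    refine le_lscWrt (hC _) (hxnX _) ?_
    filter_upwards [self_mem_nhdsWithin, nhdsWithin_le_nhds (isOpen_ball.mem_nhds hxj)] with v hv hvx
    exact hj v hv hvx
  have hval : Tendsto (fun j => lscWrt (X (φ (ψ j))) (u (φ (ψ j))) (xn (φ (ψ j)))) atTop
      (𝓝 (lowerSemilimit X u x)) := by
    refine tendsto_order.2 ⟨fun b hb => ?_, fun b hb => ?_⟩
    · obtain ⟨b', hbb', hb'⟩ := exists_between hb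
      exact (hlower b' hb').mono fun j hj => hbb'.trans_le hj
    · refine (hupper'.eventually_lt_const (show _ < b by linarith)).mono fun j hj => ?_
      exact (hupper j).trans_lt hj
  have hxz : lowerSemilimit X u x ≤
      lowerSemilimit X u z + c * di z y ^ 2 - c * di x y ^ 2 :=
    le_of_tendsto_of_tendsto' hval hupper' hupper
  refine ⟨x, hx, by linarith, ?_⟩
  have hp := hmeti.nonneg hx hy
  obtain ⟨g, hgX, hgx⟩ := hX x hx
  obtain ⟨e, heX, hex, hef⟩ := exists_tendsto_extending hσ hxlim hgx (fun j => hxnX _) hgX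
  obtain ⟨r, -, hr, hrj⟩ := exists_tendsto_extending hσ hval tendsto_const_nhds
    (A := fun _ => univ) (fun _ => mem_univ _) fun _ => mem_univ _
  obtain ⟨q, hq0, hq, hqj⟩ := exists_tendsto_extending hσ (hdx.const_mul (2 * c))
    tendsto_const_nhds (A := fun _ => Ici 0)
    (fun j => by
      have := (hmet (φ (ψ j))).nonneg (hxnX _) (hynX _)
      rw [mem_Ici]
      positivity)
    (fun _ => by
      rw [mem_Ici]
      positivity)
  have hlim := (h3 x hx e heX hex _ _ (by positivity) r q hq0 hr hq).comp hσ.tendsto_atTop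
  refine ge_of_tendsto' hlim fun j => ?_
  simp only [Function.comp_apply, hef, hrj, hqj]
  exact hxnH _

theorem IsMVSupersolutionWrt.of_forall_isMinOn {S : Set Y} {ρ : Y → Y → ℝ} {G : Y → ℝ → ℝ → ℝ}
    {w : Y → ℝ} (h : IsMetricOn S ρ) (hg : IsGeodesicWrt S ρ) (hS : IsCompact S)
    (hG : ContinuousOn (fun q : Y × ℝ × ℝ => G q.1 q.2.1 q.2.2)
      (S ×ˢ (univ : Set ℝ) ×ˢ Ici (0 : ℝ)))
    (hw : LowerSemicontinuousOn w S) (hC : ∀ x ∈ S, |w x| ≤ C)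
    (hmin : ∀ c > 0, ∀ y ∈ S, ∀ z ∈ S, IsMinOn (fun x => w x + c * ρ x y ^ 2) S z →
      ∃ x ∈ S, w x + c * ρ x y ^ 2 ≤ w z + c * ρ z y ^ 2 ∧ 0 ≤ G x (w x) (2 * c * ρ x y)) :
    IsMVSupersolutionWrt S ρ G w := by
  intro ψ₁ ψ₂ h₁ h₂ o ho hloc
  have hlsc : ∀ x ∈ S, lscWrt S w x = w x := fun x hx =>
    lscWrt_eq_of_lowerSemicontinuousOn hw hC hx
  have hψ : LocLipWrt S ρ fun y => ψ₁ y + ψ₂ y := h₁.1.add h₂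
  have hψc := hψ.continuousOn h
  rw [hlsc o ho]
  obtain ⟨K, hK, ε₁, hε₁, hKε⟩ := hψ.exists_nonneg h ho
  obtain ⟨ε₂, hε₂, hlocε⟩ := (h.nhds_basis o ho).eventually_iff.1 hloc
  obtain ⟨R, hR, hR₁, hR₂⟩ : ∃ R > 0, 2 * R ≤ ε₁ ∧ 2 * R ≤ ε₂ :=
    ⟨min ε₁ ε₂ / 2, by positivity, by linarith [min_le_left ε₁ ε₂],
      by linarith [min_le_right ε₁ ε₂]⟩
  have hρo : ContinuousOn (fun y => ρ y o) S :=
    h.continuousOn.comp (continuousOn_id.prodMk continuousOn_const) fun y hy => ⟨hy, ho⟩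
  have hB : IsCompact (S ∩ (fun y => ρ y o) ⁻¹' Iic R) :=
    hS.of_isClosed_subset (hρo.preimage_isClosed_of_isClosed hS.isClosed isClosed_Iic)
      inter_subset_left
  have hoo := h.refl o ho
  have hpt : ∀ m : ℕ, ∃ x ∈ S, ∃ y ∈ S, ρ y o ≤ R ∧
      0 ≤ G x (w x) (2 * ((m : ℝ) + 1) * ρ x y) ∧ ∀ x' ∈ S, ∀ y' ∈ S, ρ y' o ≤ R →
      w x - (ψ₁ y + ψ₂ y) + ρ y o ^ 2 + ((m : ℝ) + 1) * ρ x y ^ 2 ≤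
      w x' - (ψ₁ y' + ψ₂ y') + ρ y' o ^ 2 + ((m : ℝ) + 1) * ρ x' y' ^ 2 := by
    intro m
    obtain ⟨⟨z, y⟩, ⟨hz, hy, hyR⟩, hzy⟩ := LowerSemicontinuousOn.exists_isMinOn
      (f := fun p : Y × Y => w p.1 +
        (ρ p.2 o ^ 2 - (ψ₁ p.2 + ψ₂ p.2) + ((m : ℝ) + 1) * ρ p.1 p.2 ^ 2))
      (s := S ×ˢ (S ∩ (fun y => ρ y o) ⁻¹' Iic R)) ⟨(o, o), ho, ho, by simpa [hoo] using hR.le⟩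
      (hS.prod hB) (by
        refine LowerSemicontinuousOn.add (hw.comp continuousOn_fst fun p hp => hp.1)
          (ContinuousOn.lowerSemicontinuousOn ?_)
        have hsnd : MapsTo Prod.snd (S ×ˢ (S ∩ (fun y => ρ y o) ⁻¹' Iic R)) S :=
          fun p hp => hp.2.1
        refine (((hρo.comp continuousOn_snd hsnd).pow 2).sub
          (hψc.comp continuousOn_snd hsnd)).add (continuousOn_const.mul ((h.continuousOn.mono
            (prod_mono_right inter_subset_left)).pow 2)))
    have hzy' : ∀ x' ∈ S, ∀ y' ∈ S, ρ y' o ≤ R → w z + (ρ y o ^ 2 - (ψ₁ y + ψ₂ y)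
        + ((m : ℝ) + 1) * ρ z y ^ 2) ≤ w x' + (ρ y' o ^ 2 - (ψ₁ y' + ψ₂ y')
        + ((m : ℝ) + 1) * ρ x' y' ^ 2) := fun x' hx' y' hy' hyR' =>
      hzy (show (x', y') ∈ S ×ˢ (S ∩ (fun y => ρ y o) ⁻¹' Iic R) from ⟨hx', hy', hyR'⟩)
    obtain ⟨x, hx, hxz, hxG⟩ := hmin ((m : ℝ) + 1) (by positivity) y hy z hz fun x' hx' => by
      have := hzy' x' hx' y hy hyR
      simp only [mem_ofPred_eq]
      linarith
    refine ⟨x, hx, y, hy, hyR, hxG, fun x' hx' y' hy' hyR' => ?_⟩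
    have := hzy' x' hx' y' hy' hyR'
    linarith
  choose x hx y hy hyR hxG hxy using hpt
  have hρ0 : ∀ m, 0 ≤ ρ (x m) (y m) := fun m => h.nonneg (hx m) (hy m)
  have hLip : ∀ a ∈ S, ρ a o < 2 * R → ∀ b ∈ S, ρ b o < 2 * R →
      |(ψ₁ a + ψ₂ a) - (ψ₁ b + ψ₂ b)| ≤ K * ρ a b := by
    intro a ha hao b hb hbo
    rw [h.symm a ha o ho] at hao
    rw [h.symm b hb o ho] at hbo
    exact hKε a ha (hao.trans_le hR₁) b hb (hbo.trans_le hR₁)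
  have hbase : ∀ m, w (x m) - (ψ₁ (y m) + ψ₂ (y m)) + ρ (y m) o ^ 2
      + ((m : ℝ) + 1) * ρ (x m) (y m) ^ 2 ≤ w o - (ψ₁ o + ψ₂ o) := by
    intro m
    have := hxy m o ho o ho (by rw [hoo]; exact hR.le)
    rw [hoo] at this
    linarith
  have hsq : ∀ m : ℕ, ρ (x m) (y m) ^ 2 ≤ (2 * C + K * R) * (1 / ((m : ℝ) + 1)) := by
    intro m
    have e₁ := hbase m
    have e₂ := (abs_le.1 (hLip (y m) (hy m) (by linarith [hyR m]) o ho (by linarith))).2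
    have e₃ := (abs_le.1 (hC _ (hx m))).1
    have e₄ := (abs_le.1 (hC o ho)).2
    have e₅ := mul_le_mul_of_nonneg_left (hyR m) hK
    rw [mul_one_div, le_div_iff₀ (by positivity)]
    nlinarith [sq_nonneg (ρ (y m) o)]
  have hρlim : Tendsto (fun m => ρ (x m) (y m)) atTop (𝓝 0) := by
    have hsq' : Tendsto (fun m => ρ (x m) (y m) ^ 2) atTop (𝓝 0) := by
      refine squeeze_zero (fun _ => sq_nonneg _) hsq ?_
      simpa using (tendsto_one_div_add_atTop_nhds_zero_nat (𝕜 := ℝ)).const_mul (2 * C + K * R)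
    have := hsq'.sqrt
    rw [Real.sqrt_zero] at this
    exact this.congr fun m => Real.sqrt_sq (hρ0 m)
  have hxo : ∀ᶠ m in atTop, ρ (x m) o < 2 * R := by
    filter_upwards [hρlim.eventually_lt_const hR] with m hm
    linarith [h.triangle _ (hx m) _ (hy m) _ ho, hyR m]
  have hwx : ∀ᶠ m in atTop, w o - (ψ₁ o + ψ₂ o) ≤ w (x m) - (ψ₁ (x m) + ψ₂ (x m)) := by
    filter_upwards [hxo] with m hm
    rw [h.symm _ (hx m) _ ho] at hm
    have := hlocε ⟨hx m, hm.trans_le hR₂⟩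
    simpa only [hlsc o ho, hlsc _ (hx m)] using this
  have hkey : ∀ᶠ m : ℕ in atTop, ρ (y m) o ^ 2 + ((m : ℝ) + 1) * ρ (x m) (y m) ^ 2 ≤
      K * ρ (x m) (y m) := by
    filter_upwards [hxo, hwx] with m hm hm'
    have e₁ := hbase m
    have e₂ := (abs_le.1 (hLip (x m) (hx m) hm (y m) (hy m) (by linarith [hyR m]))).1
    linarith
  have hyo : Tendsto (fun m => ρ (y m) o) atTop (𝓝 0) := by
    have hsq' : Tendsto (fun m => ρ (y m) o ^ 2) atTop (𝓝 0) := by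
      refine squeeze_zero' (Eventually.of_forall fun _ => sq_nonneg _) ?_
        (by simpa using hρlim.const_mul K)
      filter_upwards [hkey] with m hm
      have : 0 ≤ ((m : ℝ) + 1) * ρ (x m) (y m) ^ 2 := by positivity
      linarith
    have := hsq'.sqrt
    rw [Real.sqrt_zero] at this
    exact this.congr fun m => Real.sqrt_sq (h.nonneg (hy m) ho)
  have hq : ∀ᶠ m : ℕ in atTop, 2 * ((m : ℝ) + 1) * ρ (x m) (y m) ∈ Icc 0 (2 * K) := by
    filter_upwards [hkey] with m hm
    refine ⟨mul_nonneg (by positivity) (hρ0 m), ?_⟩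
    rcases (hρ0 m).eq_or_lt with h0 | hpos
    · rw [← h0, mul_zero]
      positivity
    · have : ((m : ℝ) + 1) * ρ (x m) (y m) ≤ K := by
        refine le_of_mul_le_mul_right ?_ hpos
        nlinarith [sq_nonneg (ρ (y m) o)]
      linarith
  have hconv : ∀ v : ℕ → Y, (∀ m, v m ∈ S) → Tendsto (fun m => ρ (v m) o) atTop (𝓝 0) →
      Tendsto v atTop (𝓝[S] o) := by
    intro v hv hvo
    refine (h.nhds_basis o ho).tendsto_right_iff.2 fun ε hε => ?_
    filter_upwards [hvo.eventually_lt_const hε] with m hm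
    exact ⟨hv m, by rwa [h.symm o ho _ (hv m)]⟩
  have hylim := hconv y hy hyo
  have hxlim := hconv x hx (squeeze_zero (fun m => h.nonneg (hx m) ho)
    (fun m => h.triangle _ (hx m) _ (hy m) _ ho) (by simpa using hρlim.add hyo))
  have hψo : ContinuousWithinAt (fun y => ψ₁ y + ψ₂ y) S o := hψc o ho
  have hwlim : Tendsto (fun m => w (x m)) atTop (𝓝 (w o)) := by
    refine tendsto_of_tendsto_of_tendsto_of_le_of_le'
      (g := fun m => w o - (ψ₁ o + ψ₂ o) + (ψ₁ (x m) + ψ₂ (x m)))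
      (h := fun m => w o - (ψ₁ o + ψ₂ o) + (ψ₁ (y m) + ψ₂ (y m))) ?_ ?_ ?_ ?_
    · simpa using (hψo.tendsto.comp hxlim).const_add (w o - (ψ₁ o + ψ₂ o))
    · simpa using (hψo.tendsto.comp hylim).const_add (w o - (ψ₁ o + ψ₂ o))
    · filter_upwards [hwx] with m hm
      linarith
    · refine Eventually.of_forall fun m => ?_
      have : 0 ≤ ((m : ℝ) + 1) * ρ (x m) (y m) ^ 2 := by positivity
      linarith [hbase m, sq_nonneg (ρ (y m) o)]
  have hslope : ∀ᶠ m : ℕ in atTop, |2 * ((m : ℝ) + 1) * ρ (x m) (y m) - slopeWrt S ρ ψ₁ (y m)| ≤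
      slopeWrt S ρ ψ₂ (y m) + 2 * ρ (y m) o := by
    filter_upwards [hyo.eventually_lt_const hR] with m hm
    rw [h.symm _ (hx m) _ (hy m)]
    refine h.abs_sub_slopeWrt_le hg h₁ h₂ (by positivity) ho (hx m) (hy m) ?_
    have hev : ∀ᶠ z in 𝓝[S] (y m), z ∈ S ∧ ρ (y m) z < R - ρ (y m) o :=
      h.eventually_lt (hy m) (sub_pos.2 hm)
    refine hev.mono fun z hz => ?_
    have hzo := h.triangle z hz.1 _ (hy m) _ ho
    rw [h.symm z hz.1 _ (hy m)] at hzo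
    have := hxy m (x m) (hx m) z hz.1 (by linarith [hz.2])
    rw [h.symm _ (hx m) _ (hy m), h.symm _ (hx m) _ hz.1] at this
    simp only
    linarith
  obtain ⟨q, hqK, φ, hφ, hqlim⟩ := isCompact_Icc.tendsto_subseq' hq.frequently
  have hφt := hφ.tendsto_atTop
  have hGlim : 0 ≤ G o (w o) q := by
    have hGo := hG (o, w o, q) ⟨ho, mem_univ _, hqK.1⟩
    have ht : Tendsto (fun j => (x (φ j), w (x (φ j)),
        2 * ((φ j : ℝ) + 1) * ρ (x (φ j)) (y (φ j)))) atTop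
        (𝓝[S ×ˢ (univ : Set ℝ) ×ˢ Ici (0 : ℝ)] (o, w o, q)) := by
      refine tendsto_nhdsWithin_iff.2 ⟨?_, Eventually.of_forall fun j =>
        ⟨hx _, mem_univ _, mul_nonneg (by positivity) (hρ0 _)⟩⟩
      exact ((hxlim.mono_right nhdsWithin_le_nhds).comp hφt).prodMk_nhds
        ((hwlim.comp hφt).prodMk_nhds hqlim)
    exact ge_of_tendsto' (hGo.tendsto.comp ht) fun j => hxG (φ j)
  have hqa : |q - slopeWrt S ρ ψ₁ o| ≤ uscWrt S (slopeWrt S ρ ψ₂) o := by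
    refine le_of_forall_pos_le_add fun ε hε => ?_
    obtain ⟨L, -, hL⟩ := h₂.eventually_slopeWrt_le h ho
    have hs₂ : ∀ᶠ v in 𝓝[S] o, slopeWrt S ρ ψ₂ v < uscWrt S (slopeWrt S ρ ψ₂) o + ε :=
      eventually_lt_of_limsup_lt (lt_add_of_pos_right _ hε)
        (isBoundedUnder_of_eventually_le (hL.mono fun v hv => hv.2))
    have hs₁ : Tendsto (fun m => slopeWrt S ρ ψ₁ (y m)) atTop (𝓝 (slopeWrt S ρ ψ₁ o)) :=
      (h₁.2.1 o ho).tendsto.comp hylim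
    have hright := (hyo.const_mul 2).const_add (uscWrt S (slopeWrt S ρ ψ₂) o + ε)
    rw [mul_zero, add_zero] at hright
    refine le_of_tendsto_of_tendsto (hqlim.sub (hs₁.comp hφt)).abs (hright.comp hφt) ?_
    filter_upwards [hφt.eventually hslope, hφt.eventually (hylim.eventually hs₂)] with j hj hj'
    refine hj.trans ?_
    simp only [Function.comp_apply]
    linarith
  refine hGlim.trans (le_csSup ?_ ⟨q, ⟨hqK.1, hqa⟩, rfl⟩)
  refine (IsCompact.image_of_continuousOn (s := Icc 0 (slopeWrt S ρ ψ₁ o +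
    uscWrt S (slopeWrt S ρ ψ₂) o)) isCompact_Icc ?_).bddAbove.mono (image_mono fun t ht => ?_)
  · exact hG.comp (continuousOn_const.prodMk (continuousOn_const.prodMk continuousOn_id))
      fun t ht => ⟨ho, mem_univ _, ht.1⟩
  · exact ⟨ht.1, by linarith [(abs_le.1 ht.2).2]⟩

end Stability

/-- STATEMENT 8: stability of metric viscosity supersolutions under Hausdorff convergence
(compact case). -/
theorem stmt9 {Y : Type*} [MetricSpace Y] [LocallyCompactSpace Y]
    (X : ℕ → Set Y) (Xi : Set Y)
    (d : ℕ → Y → Y → ℝ) (di : Y → Y → ℝ)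
    (H : ℕ → Y → ℝ → ℝ → ℝ) (Hi : Y → ℝ → ℝ → ℝ)
    (u : ℕ → Y → ℝ)
    (hXne : ∀ n, (X n).Nonempty) (hXc : ∀ n, IsCompact (X n))
    (hXine : Xi.Nonempty) (hXic : IsCompact Xi)
    (hmet : ∀ n, IsMetricOn (X n) (d n)) (hgeo : ∀ n, IsGeodesicWrt (X n) (d n))
    (hmeti : IsMetricOn Xi di) (hgeoi : IsGeodesicWrt Xi di)
    (hHc : ∀ n, ContinuousOn (fun q : Y × ℝ × ℝ => H n q.1 q.2.1 q.2.2)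
      (X n ×ˢ (univ : Set ℝ) ×ˢ Ici (0:ℝ)))
    (hHic : ContinuousOn (fun q : Y × ℝ × ℝ => Hi q.1 q.2.1 q.2.2)
      (Xi ×ˢ (univ : Set ℝ) ×ˢ Ici (0:ℝ)))
    (h1 : Tendsto (fun n => hausdorffDist (X n) Xi) atTop (𝓝 0))
    (h2 : ∀ a ∈ Xi, ∀ b ∈ Xi, ∀ an bn : ℕ → Y, (∀ n, an n ∈ X n) → (∀ n, bn n ∈ X n) →
      Tendsto an atTop (𝓝 a) → Tendsto bn atTop (𝓝 b) →
      Tendsto (fun n => d n (an n) (bn n)) atTop (𝓝 (di a b)))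
    (h3 : ∀ x ∈ Xi, ∀ xn : ℕ → Y, (∀ n, xn n ∈ X n) → Tendsto xn atTop (𝓝 x) →
      ∀ r p : ℝ, 0 ≤ p → ∀ rn pn : ℕ → ℝ, (∀ n, 0 ≤ pn n) →
      Tendsto rn atTop (𝓝 r) → Tendsto pn atTop (𝓝 p) →
      Tendsto (fun n => H n (xn n) (rn n) (pn n)) atTop (𝓝 (Hi x r p)))
    (hsup : ∀ n, IsMVSupersolutionWrt (X n) (d n) (H n) (u n))
    (hbdd : ∃ C : ℝ, ∀ n, ∀ x ∈ X n, |u n x| ≤ C) :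
    IsMVSupersolutionWrt Xi di Hi (fun x => sInf {L : ℝ | ∃ xn : ℕ → Y,
      (∀ n, xn n ∈ X n) ∧ Tendsto xn atTop (𝓝 x) ∧
      Filter.liminf (fun n => u n (xn n)) atTop = L}) := by
  obtain ⟨C, hC⟩ := hbdd
  have hX : ∀ x ∈ Xi, ∃ g : ℕ → Y, (∀ n, g n ∈ X n) ∧ Tendsto g atTop (𝓝 x) := fun x hx =>
    exists_tendsto_of_tendsto_hausdorffDist hXne hXc hXic h1 hx
  exact IsMVSupersolutionWrt.of_forall_isMinOn (w := lowerSemilimit X u) hmeti hgeoi hXic hHic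
    (lowerSemicontinuousOn_lowerSemilimit hC hX) (fun x hx => abs_lowerSemilimit_le hC (hX x hx))
    fun c hc y hy z hz hmin => exists_le_and_nonneg_of_isMinOn_lowerSemilimit hXne hXc hXic
      hmet hgeo hmeti h1 h2 h3 hsup hC hc hy hz hmin
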